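/- There exist a constant c ≥ 1 and an exponent θ ∈ (0,2) (one may take θ = log(L²/#A)/log L) such that for every m ≥ 0, every f : V_m → ℝ and all x, y ∈ V_m: |f(x) − f(y)|² ≤ c·|x − y|^θ·𝓡_m·D_m(f), where |x − y| denotes the Euclidean distance in ℝ². (Uniform Hölder estimate on the approximating graphs; Corollary 3.6 of the paper in the planar case.) -/

import Mathlib

open Finset
open scoped Classical

namespace Carpet

/-- The contraction map `Ψ_{(a,b)}(x,y) = ((x+a)/L, (y+b)/L)`. -/
noncomputable def Psi (L : ℕ) (p : ℕ × ℕ) (x : ℝ × ℝ) : ℝ × ℝ :=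
  ((x.1 + p.1) / L, (x.2 + p.2) / L)

/-- Words of length `n` over the alphabet `A`. -/
abbrev Word (A : Finset (ℕ × ℕ)) (n : ℕ) := Fin n → {p : ℕ × ℕ // p ∈ A}

/-- `Ψ_w = Ψ_{w₁} ∘ ⋯ ∘ Ψ_{w_n}`. -/
noncomputable def PsiW (L : ℕ) {A : Finset (ℕ × ℕ)} {n : ℕ} (w : Word A n) : ℝ × ℝ → ℝ × ℝ :=
  (List.ofFn fun i => Psi L (w i).1).foldr (· ∘ ·) id

/-- The four corners of the unit square. -/
noncomputable def V0 : Finset (ℝ × ℝ) :=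
  {((0 : ℝ), (0 : ℝ)), ((1 : ℝ), (0 : ℝ)), ((1 : ℝ), (1 : ℝ)), ((0 : ℝ), (1 : ℝ))}

/-- The level-`n` vertex set `V_n = ⋃_{w ∈ W_n} Ψ_w(V₀)`. -/
noncomputable def VN (L : ℕ) (A : Finset (ℕ × ℕ)) (n : ℕ) : Finset (ℝ × ℝ) :=
  (Finset.univ : Finset (Word A n)).biUnion fun w => V0.image (PsiW L w)

/-- Euclidean distance in the plane. -/
noncomputable def eudist (x y : ℝ × ℝ) : ℝ :=
  Real.sqrt ((x.1 - y.1) ^ 2 + (x.2 - y.2) ^ 2)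

/-- `n`-adjacency: `x = Ψ_w(p)`, `y = Ψ_w(q)` with `p, q ∈ V₀`, `|p - q| = 1`. -/
def Adj (L : ℕ) (A : Finset (ℕ × ℕ)) (n : ℕ) (x y : ℝ × ℝ) : Prop :=
  ∃ w : Word A n, ∃ p ∈ V0, ∃ q ∈ V0,
    eudist p q = 1 ∧ x = PsiW L w p ∧ y = PsiW L w q

/-- The natural graph energy `D_n(f) = Σ_{x ∼ y} (f x - f y)²`
(summing over ordered pairs and halving). -/
noncomputable def Dform (L : ℕ) (A : Finset (ℕ × ℕ)) (n : ℕ) (f : ℝ × ℝ → ℝ) : ℝ :=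
  (1 / 2) * ∑ x ∈ VN L A n, ∑ y ∈ VN L A n,
    (if Adj L A n x y then (f x - f y) ^ 2 else 0)

/-- The effective resistance between `S` and `T` in the level-`n` graph. -/
noncomputable def EffRes (L : ℕ) (A : Finset (ℕ × ℕ)) (n : ℕ) (S T : Set (ℝ × ℝ)) : ℝ :=
  (sInf {e : ℝ | ∃ f : ℝ × ℝ → ℝ,
      (∀ x ∈ S, f x = 1) ∧ (∀ x ∈ T, f x = 0) ∧ e = Dform L A n f})⁻¹

/-- `𝓡_n`, the resistance between the corners `(0,0)` and `(1,0)`. -/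
noncomputable def RR (L : ℕ) (A : Finset (ℕ × ℕ)) (n : ℕ) : ℝ :=
  EffRes L A n {((0 : ℝ), (0 : ℝ))} {((1 : ℝ), (0 : ℝ))}

/-- `𝓡̄_n`, the resistance between the left and right sides of the unit square. -/
noncomputable def RRbar (L : ℕ) (A : Finset (ℕ × ℕ)) (n : ℕ) : ℝ :=
  EffRes L A n
    ((VN L A n : Set (ℝ × ℝ)) ∩ ({(0 : ℝ)} ×ˢ Set.Icc (0 : ℝ) 1))
    ((VN L A n : Set (ℝ × ℝ)) ∩ ({(1 : ℝ)} ×ˢ Set.Icc (0 : ℝ) 1))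

/-- The standing assumptions on `(L, A)` defining a generalized Sierpiński carpet. -/
structure GoodCarpet (L : ℕ) (A : Finset (ℕ × ℕ)) : Prop where
  three_le : 3 ≤ L
  mem_lt : ∀ p ∈ A, p.1 < L ∧ p.2 < L
  symm_swap : ∀ a b : ℕ, (a, b) ∈ A → (b, a) ∈ A
  symm_reflect : ∀ a b : ℕ, (a, b) ∈ A → (L - 1 - a, b) ∈ A
  connected : IsConnected
    (⋃ p ∈ A, Set.Icc (((p.1 : ℝ) / L, (p.2 : ℝ) / L) : ℝ × ℝ)
      ((((p.1 : ℝ) + 1) / L, ((p.2 : ℝ) + 1) / L) : ℝ × ℝ))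
  flat_border : ∀ a b : ℕ, a < L → b < L →
    (a = 0 ∨ a = L - 1 ∨ b = 0 ∨ b = L - 1) → (a, b) ∈ A
  proper : ∃ a b : ℕ, a < L ∧ b < L ∧ (a, b) ∉ A

/-- The generalized Sierpiński carpet `F`. -/
def carpetF (L : ℕ) (A : Finset (ℕ × ℕ)) : Set (ℝ × ℝ) :=
  ⋂ n : ℕ, ⋃ w : Word A n, PsiW L w '' Set.Icc (((0 : ℝ), (0 : ℝ)) : ℝ × ℝ) ((1 : ℝ), (1 : ℝ))


/-- Energy of a single cell. -/
noncomputable def Q (g : ℝ × ℝ → ℝ) : ℝ :=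
  (g (0, 0) - g (1, 0)) ^ 2 + (g (0, 1) - g (1, 1)) ^ 2 +
    (g (0, 0) - g (0, 1)) ^ 2 + (g (1, 0) - g (1, 1)) ^ 2

/-- Recursive cell energy: every edge is counted once for each cell containing it. -/
noncomputable def En (L : ℕ) (A : Finset (ℕ × ℕ)) : ℕ → (ℝ × ℝ → ℝ) → ℝ
  | 0, f => Q f
  | n + 1, f => ∑ a ∈ A, En L A n (f ∘ Psi L a)

lemma Q_nonneg (g : ℝ × ℝ → ℝ) : 0 ≤ Q g := by unfold Q; positivity

lemma En_nonneg (L : ℕ) (A : Finset (ℕ × ℕ)) (n : ℕ) : ∀ f, 0 ≤ En L A n f := by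
  induction n with
  | zero => intro f; exact Q_nonneg f
  | succ n ih => intro f; exact Finset.sum_nonneg fun a _ => ih _

lemma PsiW_zero (L : ℕ) {A : Finset (ℕ × ℕ)} (w : Word A 0) : PsiW L w = id := by
  simp [PsiW]

lemma PsiW_cons (L : ℕ) {A : Finset (ℕ × ℕ)} {n : ℕ} (a : {p : ℕ × ℕ // p ∈ A})
    (w : Word A n) :
    PsiW L (Fin.cons a w : Word A (n + 1)) = Psi L a.1 ∘ PsiW L w := by
  simp [PsiW, List.ofFn_succ]

lemma En_split (L : ℕ) (A : Finset (ℕ × ℕ)) (n k : ℕ) :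
    ∀ f, En L A (n + k) f = ∑ w : Word A k, En L A n (f ∘ PsiW L w) := by
  induction k with
  | zero => intro f; simp [PsiW_zero]
  | succ k ih =>
    intro f
    have e := Fintype.sum_equiv
      (Fin.consEquiv (fun _ : Fin (k + 1) => {p : ℕ × ℕ // p ∈ A}))
      (fun z : {p : ℕ × ℕ // p ∈ A} × Word A k =>
        En L A n ((f ∘ Psi L z.1.1) ∘ PsiW L z.2))
      (fun w : Word A (k + 1) => En L A n (f ∘ PsiW L w))
      (by
        rintro ⟨a, w⟩
        have : PsiW L (Fin.cons a w : Word A (k + 1)) = Psi L a.1 ∘ PsiW L w := PsiW_cons L a w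
        show _ = En L A n (f ∘ PsiW L (Fin.cons a w : Word A (k + 1)))
        rw [this]
        rfl)
    rw [← e, Fintype.sum_prod_type]
    show ∑ a ∈ A, En L A (n + k) (f ∘ Psi L a) = _
    rw [← Finset.sum_coe_sort A]
    exact Finset.sum_congr rfl fun a _ => ih _

lemma En_cell_le (L : ℕ) (A : Finset (ℕ × ℕ)) (n k : ℕ) (f : ℝ × ℝ → ℝ) (w : Word A k) :
    En L A n (f ∘ PsiW L w) ≤ En L A (n + k) f := by
  rw [En_split]
  exact Finset.single_le_sum (f := fun w : Word A k => En L A n (f ∘ PsiW L w))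
    (fun _ _ => En_nonneg _ _ _ _) (Finset.mem_univ w)

lemma En_sub_le (L : ℕ) (A : Finset (ℕ × ℕ)) (n : ℕ) (f : ℝ × ℝ → ℝ) {a : ℕ × ℕ} (ha : a ∈ A) :
    En L A n (f ∘ Psi L a) ≤ En L A (n + 1) f :=
  Finset.single_le_sum (f := fun a => En L A n (f ∘ Psi L a))
    (fun _ _ => En_nonneg _ _ _ _) ha

lemma mem_V0 (p : ℝ × ℝ) : p ∈ V0 ↔ (p.1 = 0 ∨ p.1 = 1) ∧ (p.2 = 0 ∨ p.2 = 1) := by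
  rcases p with ⟨a, b⟩
  simp only [V0, Finset.mem_insert, Finset.mem_singleton, Prod.mk.injEq]
  tauto

lemma mem_VN {L : ℕ} {A : Finset (ℕ × ℕ)} {n : ℕ} {x : ℝ × ℝ} :
    x ∈ VN L A n ↔ ∃ w : Word A n, ∃ p ∈ V0, PsiW L w p = x := by
  simp only [VN, Finset.mem_biUnion, Finset.mem_univ, true_and, Finset.mem_image]

lemma mem_VN_succ {L : ℕ} {A : Finset (ℕ × ℕ)} {n : ℕ} {x : ℝ × ℝ} :
    x ∈ VN L A (n + 1) ↔ ∃ a ∈ A, ∃ y ∈ VN L A n, Psi L a y = x := by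
  rw [mem_VN]
  constructor
  · rintro ⟨w, p, hp, rfl⟩
    refine ⟨(w 0).1, (w 0).2, PsiW L (Fin.tail w : Word A n) p, mem_VN.2 ⟨_, p, hp, rfl⟩, ?_⟩
    have := PsiW_cons L (w 0) (Fin.tail w : Word A n)
    rw [Fin.cons_self_tail] at this
    rw [this]; rfl
  · rintro ⟨a, ha, y, hy, rfl⟩
    obtain ⟨w, p, hp, rfl⟩ := mem_VN.1 hy
    exact ⟨Fin.cons ⟨a, ha⟩ w, p, hp, by rw [PsiW_cons]; rfl⟩

lemma VN_split {L : ℕ} {A : Finset (ℕ × ℕ)} {n : ℕ} (k : ℕ) :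
    ∀ {x : ℝ × ℝ}, x ∈ VN L A (n + k) →
      ∃ w : Word A k, ∃ y ∈ VN L A n, PsiW L w y = x := by
  induction k with
  | zero => intro x hx; exact ⟨Fin.elim0, x, hx, by rw [PsiW_zero]; rfl⟩
  | succ k ih =>
    intro x hx
    obtain ⟨a, ha, y, hy, rfl⟩ := mem_VN_succ.1 hx
    obtain ⟨w, z, hz, rfl⟩ := ih hy
    exact ⟨Fin.cons ⟨a, ha⟩ w, z, hz, by rw [PsiW_cons]; rfl⟩

lemma PsiW_form {L : ℕ} (hL : 0 < L) {A : Finset (ℕ × ℕ)} (k : ℕ) :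
    ∀ w : Word A k, ∃ i j : ℕ, ∀ x : ℝ × ℝ,
      PsiW L w x = ((x.1 + i) / (L : ℝ) ^ k, (x.2 + j) / (L : ℝ) ^ k) := by
  induction k with
  | zero => intro w; exact ⟨0, 0, fun x => by simp [PsiW_zero]⟩
  | succ k ih =>
    intro w
    obtain ⟨i, j, hij⟩ := ih (Fin.tail w)
    refine ⟨i + (w 0).1.1 * L ^ k, j + (w 0).1.2 * L ^ k, fun x => ?_⟩
    have := PsiW_cons L (w 0) (Fin.tail w : Word A k)
    rw [Fin.cons_self_tail] at this
    have h0 : (L : ℝ) ≠ 0 := by positivity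
    rw [this, Function.comp, hij]
    simp only [Psi, Prod.mk.injEq]
    push_cast
    constructor <;> field_simp <;> ring

lemma VN_mem_Icc {L : ℕ} {A : Finset (ℕ × ℕ)} (h : GoodCarpet L A) (n : ℕ) :
    ∀ x ∈ VN L A n, (0 ≤ x.1 ∧ x.1 ≤ 1) ∧ (0 ≤ x.2 ∧ x.2 ≤ 1) := by
  induction n with
  | zero =>
    intro x hx
    obtain ⟨w, p, hp, rfl⟩ := mem_VN.1 hx
    rw [PsiW_zero]
    obtain ⟨h1, h2⟩ := (mem_V0 p).1 hp
    rcases h1 with h1 | h1 <;> rcases h2 with h2 | h2 <;> simp [h1, h2]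
  | succ n ih =>
    intro x hx
    obtain ⟨a, ha, y, hy, rfl⟩ := mem_VN_succ.1 hx
    obtain ⟨⟨h1, h2⟩, h3, h4⟩ := ih y hy
    have hL : (0 : ℝ) < L := by have := h.three_le; exact_mod_cast (by omega : 0 < L)
    obtain ⟨l1, l2⟩ := h.mem_lt a ha
    have l1' : (a.1 : ℝ) + 1 ≤ L := by exact_mod_cast l1
    have l2' : (a.2 : ℝ) + 1 ≤ L := by exact_mod_cast l2
    simp only [Psi]
    refine ⟨⟨by positivity, ?_⟩, by positivity, ?_⟩
    · rw [div_le_one hL]; linarith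
    · rw [div_le_one hL]; linarith

lemma V0_sub_VN {L : ℕ} {A : Finset (ℕ × ℕ)} (h : GoodCarpet L A) (n : ℕ) :
    ∀ p ∈ V0, p ∈ VN L A n := by
  have hL3 := h.three_le
  have hL : (0 : ℝ) < L := by exact_mod_cast (by omega : 0 < L)
  induction n with
  | zero => intro p hp; exact mem_VN.2 ⟨Fin.elim0, p, hp, by rw [PsiW_zero]; rfl⟩
  | succ n ih =>
    intro p hp
    rw [mem_VN_succ]
    have key : ∀ s : ℝ, s = 0 ∨ s = 1 → ∃ a : ℕ, a < L ∧ (a = 0 ∨ a = L - 1) ∧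
        (s + a) / L = s := by
      rintro s (rfl | rfl)
      · exact ⟨0, by omega, Or.inl rfl, by simp⟩
      · refine ⟨L - 1, by omega, Or.inr rfl, ?_⟩
        rw [Nat.cast_sub (by omega)]
        push_cast
        rw [div_eq_iff hL.ne']; ring
    obtain ⟨h1, h2⟩ := (mem_V0 p).1 hp
    obtain ⟨a, ha, ha', e1⟩ := key _ h1
    obtain ⟨b, hb, hb', e2⟩ := key _ h2
    refine ⟨(a, b), h.flat_border a b ha hb (by tauto), p, ih p hp, ?_⟩
    simp only [Psi, e1, e2]

lemma corner_diff (g : ℝ × ℝ → ℝ) {p q : ℝ × ℝ} (hp : p ∈ V0) (hq : q ∈ V0) :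
    (g p - g q) ^ 2 ≤ 2 * Q g := by
  rcases p with ⟨a, b⟩
  rcases q with ⟨c, d⟩
  obtain ⟨h1, h2⟩ := (mem_V0 _).1 hp
  obtain ⟨h3, h4⟩ := (mem_V0 _).1 hq
  simp only at h1 h2 h3 h4
  unfold Q
  generalize h00 : g (0, 0) = w
  generalize h10 : g (1, 0) = x
  generalize h01 : g (0, 1) = y
  generalize h11 : g (1, 1) = z
  rcases h1 with rfl | rfl <;> rcases h2 with rfl | rfl <;> rcases h3 with rfl | rfl <;>
    rcases h4 with rfl | rfl <;> simp only [h00, h10, h01, h11] <;>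
    nlinarith [sq_nonneg (w - x), sq_nonneg (y - z), sq_nonneg (w - y), sq_nonneg (x - z),
      sq_nonneg (w - x - (x - z)), sq_nonneg (y - w - (w - x))]

lemma share_one {i i' : ℕ} (h1 : i ≤ i' + 1) (h2 : i' ≤ i + 1) :
    ∃ s t : ℝ, (s = 0 ∨ s = 1) ∧ (t = 0 ∨ t = 1) ∧ s + i = t + i' := by
  rcases lt_trichotomy i i' with hh | hh | hh
  · have : i' = i + 1 := by omega
    exact ⟨1, 0, by simp, by simp, by subst this; push_cast; ring⟩
  · exact ⟨0, 0, by simp, by simp, by rw [hh]⟩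
  · have : i = i' + 1 := by omega
    exact ⟨0, 1, by simp, by simp, by subst this; push_cast; ring⟩

lemma share_corner {i j i' j' : ℕ} (h1 : i ≤ i' + 1) (h2 : i' ≤ i + 1)
    (h3 : j ≤ j' + 1) (h4 : j' ≤ j + 1) :
    ∃ p ∈ V0, ∃ q ∈ V0, p.1 + i = q.1 + i' ∧ p.2 + j = q.2 + j' := by
  obtain ⟨s, t, hs, ht, e⟩ := share_one h1 h2
  obtain ⟨s', t', hs', ht', he⟩ := share_one h3 h4
  exact ⟨(s, s'), (mem_V0 _).2 ⟨hs, hs'⟩, (t, t'), (mem_V0 _).2 ⟨ht, ht'⟩, e, he⟩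

/-- Bilinear interpolation of corner values. -/
noncomputable def bil (g : ℝ × ℝ → ℝ) (x : ℝ × ℝ) : ℝ :=
  (1 - x.1) * (1 - x.2) * g (0, 0) + x.1 * (1 - x.2) * g (1, 0) +
    (1 - x.1) * x.2 * g (0, 1) + x.1 * x.2 * g (1, 1)

/-- Piecewise bilinear interpolation from the lattice of mesh `1/N`. -/
noncomputable def lat (N : ℝ) (f : ℝ × ℝ → ℝ) (x : ℝ × ℝ) : ℝ :=
  bil (fun p => f ((p.1 + ⌊x.1 * N⌋) / N, (p.2 + ⌊x.2 * N⌋) / N))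
    (Int.fract (x.1 * N), Int.fract (x.2 * N))

lemma floor_cases (s : ℝ) (h0 : 0 ≤ s) (h1 : s ≤ 1) (i : ℕ) :
    (⌊s + i⌋ = (i : ℤ) ∧ Int.fract (s + i) = s) ∨
      (s = 1 ∧ ⌊s + i⌋ = (i : ℤ) + 1 ∧ Int.fract (s + i) = 0) := by
  rcases h1.lt_or_eq with h | h
  · left
    have e : ⌊s + i⌋ = (i : ℤ) := by
      rw [Int.floor_eq_iff]; push_cast; constructor <;> linarith
    refine ⟨e, ?_⟩
    rw [Int.fract, e]; push_cast; ring
  · right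
    have e : ⌊s + i⌋ = (i : ℤ) + 1 := by
      rw [Int.floor_eq_iff]; push_cast; constructor <;> linarith
    refine ⟨h, e, ?_⟩
    rw [Int.fract, e, h]; push_cast; ring

lemma lat_cell {N : ℝ} (hN : 0 < N) (f : ℝ × ℝ → ℝ) (x : ℝ × ℝ) (i j : ℕ)
    (h1 : 0 ≤ x.1 ∧ x.1 ≤ 1) (h2 : 0 ≤ x.2 ∧ x.2 ≤ 1) :
    lat N f ((x.1 + i) / N, (x.2 + j) / N) =
      bil (fun p => f ((p.1 + i) / N, (p.2 + j) / N)) x := by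
  unfold lat
  simp only [div_mul_cancel₀ _ hN.ne']
  rcases x with ⟨s, t⟩
  simp only at h1 h2 ⊢
  rcases floor_cases s h1.1 h1.2 i with ⟨a1, a2⟩ | ⟨a0, a1, a2⟩ <;>
  rcases floor_cases t h2.1 h2.2 j with ⟨b1, b2⟩ | ⟨b0, b1, b2⟩ <;>
  rw [a1, a2, b1, b2] <;> simp only [bil]
  · simp
  · subst b0; simp [add_comm]
  · subst a0; simp [add_comm]
  · subst a0 b0; simp [add_comm]

/-- One-dimensional trapezoid bound. -/
lemma trap_sum (L : ℕ) (hL : 0 < L) (d e : ℝ) :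
    ∑ b ∈ Finset.range L, (((1 - b / L) * d + b / L * e) ^ 2 +
      ((1 - (b + 1) / L) * d + (b + 1) / L * e) ^ 2) ≤ L * (d ^ 2 + e ^ 2) := by
  have hL' : (0 : ℝ) < L := by exact_mod_cast hL
  have conv : ∀ t : ℝ, 0 ≤ t → t ≤ 1 → ((1 - t) * d + t * e) ^ 2 ≤ (1 - t) * d ^ 2 + t * e ^ 2 := by
    intro t h0 h1
    have : 0 ≤ t * (1 - t) * (d - e) ^ 2 := by
      have : 0 ≤ 1 - t := by linarith
      positivity
    nlinarith
  have h1 : ∀ b ∈ Finset.range L, (((1 - b / L) * d + b / L * e) ^ 2 +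
      ((1 - (b + 1) / L) * d + (b + 1) / L * e) ^ 2 : ℝ) ≤
      2 * d ^ 2 + (2 * b + 1) * ((e ^ 2 - d ^ 2) / L) := by
    intro b hb
    have hb' : (b : ℝ) + 1 ≤ L := by exact_mod_cast Finset.mem_range.1 hb
    have c1 := conv (b / L) (by positivity) (by rw [div_le_one hL']; linarith)
    have c2 := conv ((b + 1) / L) (by positivity) (by rw [div_le_one hL']; linarith)
    have : (2 * b + 1) * ((e ^ 2 - d ^ 2) / L) = (b / L + (b + 1) / L) * (e ^ 2 - d ^ 2) := by
      field_simp; ring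
    rw [this]; linarith
  refine (Finset.sum_le_sum h1).trans (le_of_eq ?_)
  rw [Finset.sum_add_distrib, ← Finset.sum_mul _ _ ((e ^ 2 - d ^ 2) / (L : ℝ))]
  have h2 : ∀ M : ℕ, ∑ b ∈ Finset.range M, (2 * (b : ℝ) + 1) = M ^ 2 := by
    intro M
    induction M with
    | zero => simp
    | succ M ih => rw [Finset.sum_range_succ, ih]; push_cast; ring
  rw [h2]
  simp only [Finset.sum_const, Finset.card_range, nsmul_eq_mul]
  field_simp; ring

lemma single_lower (L b : ℕ) (hb : b < L) (d e : ℝ) :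
    (d ^ 2 + e ^ 2) / (4 * L ^ 4) ≤ (((1 - b / L) * d + b / L * e) / L) ^ 2 +
      (((1 - (b + 1) / L) * d + (b + 1) / L * e) / L) ^ 2 := by
  have hL' : (0 : ℝ) < L := by exact_mod_cast (by omega : 0 < L)
  have hb' : (b : ℝ) + 1 ≤ L := by exact_mod_cast hb
  have hb0 : (0 : ℝ) ≤ b := by positivity
  set u : ℝ := (1 - b / L) * d + b / L * e with hu
  set v : ℝ := (1 - (b + 1) / L) * d + (b + 1) / L * e with hv
  have hd : d = (1 + b) * u - b * v := by rw [hu, hv]; field_simp; ring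
  have he : e = (L - b) * v - (L - b - 1) * u := by rw [hu, hv]; field_simp; ring
  have aux : ∀ s t : ℝ, 0 ≤ s → s ≤ L → 0 ≤ t → t ≤ L →
      (s * u - t * v) ^ 2 ≤ 2 * L ^ 2 * (u ^ 2 + v ^ 2) := by
    intro s t hs hs' ht ht'
    have h1 : s ^ 2 ≤ L ^ 2 := by gcongr
    have h2 : t ^ 2 ≤ L ^ 2 := by gcongr
    have h3 := mul_le_mul_of_nonneg_right h1 (sq_nonneg u)
    have h4 := mul_le_mul_of_nonneg_right h2 (sq_nonneg v)
    nlinarith [sq_nonneg (s * u + t * v)]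
  have d2 : d ^ 2 ≤ 2 * L ^ 2 * (u ^ 2 + v ^ 2) := by
    rw [hd]; exact aux _ _ (by linarith) (by linarith) hb0 (by linarith)
  have e2 : e ^ 2 ≤ 2 * L ^ 2 * (u ^ 2 + v ^ 2) := by
    rw [he]
    have := aux (L - b - 1) (L - b) (by linarith) (by linarith) (by linarith) (by linarith)
    nlinarith
  rw [div_le_iff₀ (by positivity)]
  have : ((u / L) ^ 2 + (v / L) ^ 2) * (4 * (L : ℝ) ^ 4) = 4 * L ^ 2 * (u ^ 2 + v ^ 2) := by
    field_simp
  rw [this]; linarith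

lemma Q_bil (L : ℕ) (hL : 0 < L) (g : ℝ × ℝ → ℝ) (a b : ℕ) :
    Q (bil g ∘ Psi L (a, b)) =
      ((((1 - b / L) * (g (0, 0) - g (1, 0)) + b / L * (g (0, 1) - g (1, 1))) / L) ^ 2 +
      (((1 - (b + 1) / L) * (g (0, 0) - g (1, 0)) + (b + 1) / L * (g (0, 1) - g (1, 1))) / L) ^ 2)
      + ((((1 - a / L) * (g (0, 0) - g (0, 1)) + a / L * (g (1, 0) - g (1, 1))) / L) ^ 2 +
      (((1 - (a + 1) / L) * (g (0, 0) - g (0, 1)) + (a + 1) / L * (g (1, 0) - g (1, 1))) / L) ^ 2)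
      := by
  have hL' : (L : ℝ) ≠ 0 := by exact_mod_cast hL.ne'
  simp only [Q, bil, Psi, Function.comp]
  field_simp
  ring

lemma Q_bil_total (L : ℕ) (hL : 0 < L) (g : ℝ × ℝ → ℝ) :
    ∑ p ∈ Finset.range L ×ˢ Finset.range L, Q (bil g ∘ Psi L p) ≤ Q g := by
  have hL' : (0 : ℝ) < L := by exact_mod_cast hL
  have key : ∀ d e : ℝ, L * ∑ b ∈ Finset.range L, ((((1 - b / L) * d + b / L * e) / L) ^ 2 +
      (((1 - (b + 1) / L) * d + (b + 1) / L * e) / L) ^ 2) ≤ d ^ 2 + e ^ 2 := by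
    intro d e
    have h := trap_sum L hL d e
    simp only [div_pow _ (L : ℝ), ← add_div]
    rw [← Finset.sum_div]
    have : ∀ X : ℝ, L * (X / L ^ 2) = X / L := by intro X; field_simp
    rw [this, div_le_iff₀ hL']
    simp only [add_div] at h ⊢
    linarith
  rw [Finset.sum_product]
  simp only [Q_bil L hL, Finset.sum_add_distrib, Finset.sum_const, Finset.card_range, nsmul_eq_mul]
  have k1 := key (g (0, 0) - g (1, 0)) (g (0, 1) - g (1, 1))
  have k2 := key (g (0, 0) - g (0, 1)) (g (1, 0) - g (1, 1))
  rw [Finset.sum_add_distrib] at k1 k2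
  rw [Finset.mul_sum, Finset.mul_sum]
  simp only [mul_add, Finset.mul_sum] at k1 k2 ⊢
  unfold Q
  linarith

lemma Q_bil_A {L : ℕ} {A : Finset (ℕ × ℕ)} (h : GoodCarpet L A) (g : ℝ × ℝ → ℝ) :
    ∑ p ∈ A, Q (bil g ∘ Psi L p) ≤ (1 - 1 / (4 * (L : ℝ) ^ 4)) * Q g := by
  have hL : 0 < L := by have := h.three_le; omega
  obtain ⟨a, b, ha, hb, hab⟩ := h.proper
  have hsub : insert (a, b) A ⊆ Finset.range L ×ˢ Finset.range L := by
    intro p hp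
    rw [Finset.mem_insert] at hp
    rw [Finset.mem_product, Finset.mem_range, Finset.mem_range]
    rcases hp with rfl | hp
    · exact ⟨ha, hb⟩
    · exact h.mem_lt p hp
  have h1 := Finset.sum_le_sum_of_subset_of_nonneg hsub
    (f := fun p => Q (bil g ∘ Psi L p)) (fun p _ _ => Q_nonneg _)
  rw [Finset.sum_insert hab] at h1
  have h2 := h1.trans (Q_bil_total L hL g)
  have h3 : Q g / (4 * (L : ℝ) ^ 4) ≤ Q (bil g ∘ Psi L (a, b)) := by
    rw [Q_bil L hL]
    have k1 := single_lower L b hb (g (0, 0) - g (1, 0)) (g (0, 1) - g (1, 1))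
    have k2 := single_lower L a ha (g (0, 0) - g (0, 1)) (g (1, 0) - g (1, 1))
    refine le_trans (le_of_eq ?_) (add_le_add k1 k2)
    unfold Q; ring
  have : (1 - 1 / (4 * (L : ℝ) ^ 4)) * Q g = Q g - Q g / (4 * (L : ℝ) ^ 4) := by ring
  rw [this]; linarith

lemma En_lat {L : ℕ} {A : Finset (ℕ × ℕ)} (h : GoodCarpet L A) (n : ℕ) (f : ℝ × ℝ → ℝ) :
    En L A (n + 1) (lat ((L : ℝ) ^ n) f) ≤ (1 - 1 / (4 * (L : ℝ) ^ 4)) * En L A n f := by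
  have hL : 0 < L := by have := h.three_le; omega
  have hL' : (0 : ℝ) < L := by exact_mod_cast hL
  have e0 := En_split L A 0 n f
  rw [Nat.zero_add] at e0
  rw [add_comm n 1, En_split, e0, Finset.mul_sum]
  refine Finset.sum_le_sum fun w _ => ?_
  obtain ⟨i, j, hij⟩ := PsiW_form hL n w
  refine le_trans (le_of_eq ?_) (Q_bil_A h (f ∘ PsiW L w))
  show ∑ a ∈ A, Q ((lat ((L : ℝ) ^ n) f ∘ PsiW L w) ∘ Psi L a) = _
  refine Finset.sum_congr rfl fun a ha => ?_
  have hfun : f ∘ PsiW L w =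
      fun p => f ((p.1 + i) / (L : ℝ) ^ n, (p.2 + j) / (L : ℝ) ^ n) := by
    funext p; simp only [Function.comp, hij]
  obtain ⟨l1, l2⟩ := h.mem_lt a ha
  have l1' : (a.1 : ℝ) + 1 ≤ L := by exact_mod_cast l1
  have l2' : (a.2 : ℝ) + 1 ≤ L := by exact_mod_cast l2
  have key : ∀ x : ℝ × ℝ, (0 ≤ x.1 ∧ x.1 ≤ 1) → (0 ≤ x.2 ∧ x.2 ≤ 1) →
      ((lat ((L : ℝ) ^ n) f ∘ PsiW L w) ∘ Psi L a) x = (bil (f ∘ PsiW L w) ∘ Psi L a) x := by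
    rintro x ⟨x1, x2⟩ ⟨x3, x4⟩
    rw [hfun]
    simp only [Function.comp, hij]
    apply lat_cell (by positivity)
    · simp only [Psi]
      exact ⟨by positivity, by rw [div_le_one hL']; linarith⟩
    · simp only [Psi]
      exact ⟨by positivity, by rw [div_le_one hL']; linarith⟩
  unfold Q
  rw [key (0, 0) (by norm_num) (by norm_num), key (1, 0) (by norm_num) (by norm_num),
    key (0, 1) (by norm_num) (by norm_num), key (1, 1) (by norm_num) (by norm_num)]

lemma PsiW_zero_inj {L : ℕ} {A : Finset (ℕ × ℕ)} (h : GoodCarpet L A) (n : ℕ) :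
    (∀ w : Word A n, (0 ≤ (PsiW L w (0, 0)).1 ∧ (PsiW L w (0, 0)).1 < 1) ∧
      (0 ≤ (PsiW L w (0, 0)).2 ∧ (PsiW L w (0, 0)).2 < 1)) ∧
    (∀ w w' : Word A n, PsiW L w (0, 0) = PsiW L w' (0, 0) → w = w') := by
  have hL : (0 : ℝ) < L := by have := h.three_le; exact_mod_cast (by omega : 0 < L)
  induction n with
  | zero =>
    refine ⟨fun w => by simp [PsiW_zero], fun w w' _ => Subsingleton.elim _ _⟩
  | succ n ih =>
    have cons : ∀ w : Word A (n + 1), PsiW L w (0, 0) =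
        Psi L (w 0).1 (PsiW L (Fin.tail w : Word A n) (0, 0)) := by
      intro w
      have := PsiW_cons L (w 0) (Fin.tail w : Word A n)
      rw [Fin.cons_self_tail] at this
      rw [this]; rfl
    constructor
    · intro w
      rw [cons]
      obtain ⟨⟨h1, h2⟩, h3, h4⟩ := ih.1 (Fin.tail w)
      obtain ⟨l1, l2⟩ := h.mem_lt (w 0).1 (w 0).2
      have l1' : ((w 0).1.1 : ℝ) + 1 ≤ L := by exact_mod_cast l1
      have l2' : ((w 0).1.2 : ℝ) + 1 ≤ L := by exact_mod_cast l2
      simp only [Psi]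
      refine ⟨⟨by positivity, ?_⟩, by positivity, ?_⟩
      · rw [div_lt_one hL]; linarith
      · rw [div_lt_one hL]; linarith
    · intro w w' e
      rw [cons, cons] at e
      have one : ∀ (u v : ℝ) (a b : ℕ), 0 ≤ u ∧ u < 1 → 0 ≤ v ∧ v < 1 →
          (u + a) / (L : ℝ) = (v + b) / L → a = b ∧ u = v := by
        rintro u v a b ⟨u0, u1⟩ ⟨v0, v1⟩ huv
        rw [div_left_inj' hL.ne'] at huv
        have e1 : (a : ℝ) < b + 1 := by linarith
        have e2 : (b : ℝ) < a + 1 := by linarith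
        have e1' : a < b + 1 := by exact_mod_cast e1
        have e2' : b < a + 1 := by exact_mod_cast e2
        have : a = b := by omega
        subst this
        exact ⟨rfl, by linarith⟩
      simp only [Psi, Prod.mk.injEq] at e
      obtain ⟨a1, a2⟩ := ih.1 (Fin.tail w)
      obtain ⟨b1, b2⟩ := ih.1 (Fin.tail w')
      obtain ⟨x1, y1⟩ := one _ _ _ _ a1 b1 e.1
      obtain ⟨x2, y2⟩ := one _ _ _ _ a2 b2 e.2
      have t : (Fin.tail w : Word A n) = Fin.tail w' := ih.2 _ _ (Prod.ext y1 y2)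
      have z : w 0 = w' 0 := Subtype.ext (Prod.ext x1 x2)
      rw [← Fin.cons_self_tail w, ← Fin.cons_self_tail w', z, t]

lemma PsiW_inj {L : ℕ} {A : Finset (ℕ × ℕ)} (h : GoodCarpet L A) (n : ℕ) (p : ℝ × ℝ)
    (w w' : Word A n) (e : PsiW L w p = PsiW L w' p) : w = w' := by
  have hL : 0 < L := by have := h.three_le; omega
  have hL' : (0 : ℝ) < (L : ℝ) ^ n := by positivity
  obtain ⟨i, j, hij⟩ := PsiW_form hL n w
  obtain ⟨i', j', hij'⟩ := PsiW_form hL n w'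
  apply (PsiW_zero_inj h n).2
  rw [hij, hij'] at e ⊢
  simp only [Prod.mk.injEq, div_left_inj' hL'.ne'] at e ⊢
  exact ⟨by linarith [e.1], by linarith [e.2]⟩

lemma Dform_eq (L : ℕ) (A : Finset (ℕ × ℕ)) (n : ℕ) (f : ℝ × ℝ → ℝ) :
    2 * Dform L A n f = ∑ z ∈ (VN L A n ×ˢ VN L A n).filter (fun z => Adj L A n z.1 z.2),
      (f z.1 - f z.2) ^ 2 := by
  rw [Dform, Finset.sum_filter, Finset.sum_product]
  ring

lemma En_le_Dform {L : ℕ} {A : Finset (ℕ × ℕ)} (h : GoodCarpet L A) (n : ℕ) (f : ℝ × ℝ → ℝ) :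
    En L A n f ≤ 8 * Dform L A n f := by
  have key : ∀ p ∈ V0, ∀ q ∈ V0, eudist p q = 1 →
      ∑ w : Word A n, (f (PsiW L w p) - f (PsiW L w q)) ^ 2 ≤ 2 * Dform L A n f := by
    intro p hp q hq hpq
    rw [Dform_eq]
    have inj : Function.Injective (fun w : Word A n => (PsiW L w p, PsiW L w q)) := by
      intro w w' e
      exact PsiW_inj h n p w w' (Prod.mk.inj e).1
    rw [← Finset.sum_image (s := (Finset.univ : Finset (Word A n)))
      (g := fun w : Word A n => (PsiW L w p, PsiW L w q))
      (f := fun z : (ℝ × ℝ) × (ℝ × ℝ) => (f z.1 - f z.2) ^ 2) (fun a _ b _ e => inj e)]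
    apply Finset.sum_le_sum_of_subset_of_nonneg
    · intro z hz
      obtain ⟨w, _, rfl⟩ := Finset.mem_image.1 hz
      rw [Finset.mem_filter, Finset.mem_product]
      exact ⟨⟨mem_VN.2 ⟨w, p, hp, rfl⟩, mem_VN.2 ⟨w, q, hq, rfl⟩⟩, w, p, hp, q, hq, hpq, rfl, rfl⟩
    · intro z _ _; positivity
  have e0 := En_split L A 0 n f
  rw [Nat.zero_add] at e0
  rw [e0]
  have e1 : ∀ w : Word A n, En L A 0 (f ∘ PsiW L w) = Q (f ∘ PsiW L w) := fun _ => rfl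
  simp only [e1, Q, Finset.sum_add_distrib, Function.comp]
  have k1 := key (0, 0) (by simp [mem_V0]) (1, 0) (by simp [mem_V0]) (by simp [eudist])
  have k2 := key (0, 1) (by simp [mem_V0]) (1, 1) (by simp [mem_V0]) (by simp [eudist])
  have k3 := key (0, 0) (by simp [mem_V0]) (0, 1) (by simp [mem_V0]) (by simp [eudist])
  have k4 := key (1, 0) (by simp [mem_V0]) (1, 1) (by simp [mem_V0]) (by simp [eudist])
  linarith

lemma Dform_le_En {L : ℕ} {A : Finset (ℕ × ℕ)} (n : ℕ) (f : ℝ × ℝ → ℝ) :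
    Dform L A n f ≤ 16 * En L A n f := by
  have h1 : 2 * Dform L A n f ≤ ∑ w : Word A n, ∑ z ∈ V0 ×ˢ V0,
      (f (PsiW L w z.1) - f (PsiW L w z.2)) ^ 2 := by
    rw [Dform_eq, ← Finset.sum_product' (Finset.univ : Finset (Word A n)) (V0 ×ˢ V0)
      (fun w z => (f (PsiW L w z.1) - f (PsiW L w z.2)) ^ 2)]
    have h2 := Finset.sum_image_le_of_nonneg
      (s := (Finset.univ : Finset (Word A n)) ×ˢ (V0 ×ˢ V0))
      (g := fun u : Word A n × ((ℝ × ℝ) × (ℝ × ℝ)) => (PsiW L u.1 u.2.1, PsiW L u.1 u.2.2))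
      (f := fun z : (ℝ × ℝ) × (ℝ × ℝ) => (f z.1 - f z.2) ^ 2) (fun _ _ => by positivity)
    refine le_trans ?_ h2
    apply Finset.sum_le_sum_of_subset_of_nonneg
    · intro z hz
      obtain ⟨_, w, p, hp, q, hq, _, e1, e2⟩ := Finset.mem_filter.1 hz
      refine Finset.mem_image.2 ⟨(w, p, q), ?_, ?_⟩
      · simp [hp, hq]
      · exact Prod.ext e1.symm e2.symm
    · intro z _ _; positivity
  have e0 := En_split L A 0 n f
  rw [Nat.zero_add] at e0
  rw [e0, Finset.mul_sum]
  have h3 : ∑ w : Word A n, ∑ z ∈ V0 ×ˢ V0, (f (PsiW L w z.1) - f (PsiW L w z.2)) ^ 2 ≤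
      ∑ w : Word A n, 32 * En L A 0 (f ∘ PsiW L w) := by
    refine Finset.sum_le_sum fun w _ => ?_
    have h4 : ∀ z ∈ V0 ×ˢ V0, (f (PsiW L w z.1) - f (PsiW L w z.2)) ^ 2 ≤
        2 * Q (f ∘ PsiW L w) := by
      intro z hz
      obtain ⟨hz1, hz2⟩ := Finset.mem_product.1 hz
      exact corner_diff (f ∘ PsiW L w) hz1 hz2
    refine (Finset.sum_le_card_nsmul _ _ _ h4).trans ?_
    have hc : (V0.card) ≤ 4 := Finset.card_le_four
    have hc' : ((V0 ×ˢ V0).card : ℝ) ≤ 16 := by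
      rw [Finset.card_product]
      exact_mod_cast (Nat.mul_le_mul hc hc)
    rw [nsmul_eq_mul]
    have hq := Q_nonneg (f ∘ PsiW L w)
    show _ ≤ 32 * Q (f ∘ PsiW L w)
    nlinarith
  rw [← Finset.mul_sum] at h3 ⊢
  linarith

/-- Minimal cell energy between the two bottom corners. -/
noncomputable def Sn (L : ℕ) (A : Finset (ℕ × ℕ)) (n : ℕ) : ℝ :=
  sInf {e : ℝ | ∃ f : ℝ × ℝ → ℝ, f (0, 0) = 1 ∧ f (1, 0) = 0 ∧ e = En L A n f}

lemma Sn_le {L : ℕ} {A : Finset (ℕ × ℕ)} (n : ℕ) {f : ℝ × ℝ → ℝ}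
    (h1 : f (0, 0) = 1) (h0 : f (1, 0) = 0) : Sn L A n ≤ En L A n f := by
  refine csInf_le ⟨0, ?_⟩ ⟨f, h1, h0, rfl⟩
  rintro e ⟨g, _, _, rfl⟩
  exact En_nonneg _ _ _ _

lemma le_Sn {L : ℕ} {A : Finset (ℕ × ℕ)} (n : ℕ) {K : ℝ}
    (h : ∀ f : ℝ × ℝ → ℝ, f (0, 0) = 1 → f (1, 0) = 0 → K ≤ En L A n f) : K ≤ Sn L A n := by
  refine le_csInf ⟨_, fun x => 1 - x.1, by simp, by simp, rfl⟩ ?_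
  rintro e ⟨g, h1, h2, rfl⟩
  exact h g h1 h2

lemma bottom_bound {L : ℕ} {A : Finset (ℕ × ℕ)} (h : GoodCarpet L A) (n : ℕ) :
    ∀ f : ℝ × ℝ → ℝ, (f (0, 0) - f (1, 0)) ^ 2 ≤ (L : ℝ) ^ n * En L A n f := by
  have hL3 := h.three_le
  have hL : (0 : ℝ) < L := by exact_mod_cast (by omega : 0 < L)
  induction n with
  | zero =>
    intro f
    show _ ≤ (L : ℝ) ^ 0 * Q f
    unfold Q
    rw [pow_zero, one_mul]
    have := sq_nonneg (f (0, 1) - f (1, 1))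
    have := sq_nonneg (f (0, 0) - f (0, 1))
    have := sq_nonneg (f (1, 0) - f (1, 1))
    linarith
  | succ n ih =>
    intro f
    have tel := Finset.sum_range_sub' (fun a : ℕ => f ((a : ℝ) / L, 0)) L
    have e1 : (((0 : ℕ) : ℝ) / L, (0 : ℝ)) = (0, 0) := by simp
    have e2 : ((L : ℝ) / L, (0 : ℝ)) = (1, 0) := by rw [div_self hL.ne']
    rw [e1, e2] at tel
    rw [← tel]
    have cs := sq_sum_le_card_mul_sum_sq (s := Finset.range L)
      (f := fun a : ℕ => f ((a : ℝ) / L, 0) - f (((a + 1 : ℕ) : ℝ) / L, 0))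
    rw [Finset.card_range] at cs
    refine cs.trans ?_
    rw [pow_succ', mul_assoc]
    refine mul_le_mul_of_nonneg_left ?_ hL.le
    have h1 : ∀ a ∈ Finset.range L,
        (f ((a : ℝ) / L, 0) - f (((a + 1 : ℕ) : ℝ) / L, 0)) ^ 2 ≤
          (L : ℝ) ^ n * En L A n (f ∘ Psi L (a, 0)) := by
      intro a _
      have := ih (f ∘ Psi L (a, 0))
      simp only [Function.comp, Psi] at this
      convert this using 6 <;> simp [add_comm]
    refine (Finset.sum_le_sum h1).trans ?_
    rw [← Finset.mul_sum]
    refine mul_le_mul_of_nonneg_left ?_ (by positivity)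
    rw [← Finset.sum_image (s := Finset.range L) (g := fun a : ℕ => (a, 0))
      (f := fun p : ℕ × ℕ => En L A n (f ∘ Psi L p)) (fun a _ b _ e => (Prod.mk.inj e).1)]
    apply Finset.sum_le_sum_of_subset_of_nonneg
    · intro z hz
      obtain ⟨a, ha, rfl⟩ := Finset.mem_image.1 hz
      exact h.flat_border a 0 (Finset.mem_range.1 ha) (by omega) (by simp)
    · intro z _ _; exact En_nonneg _ _ _ _

lemma Sn_pos {L : ℕ} {A : Finset (ℕ × ℕ)} (h : GoodCarpet L A) (n : ℕ) : 0 < Sn L A n := by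
  have hL3 := h.three_le
  have hL : (0 : ℝ) < L := by exact_mod_cast (by omega : 0 < L)
  refine lt_of_lt_of_le (by positivity : 0 < 1 / (L : ℝ) ^ n) (le_Sn n fun f h1 h0 => ?_)
  have := bottom_bound h n f
  rw [h1, h0] at this
  rw [div_le_iff₀ (by positivity)]
  linarith

lemma En_affine (L : ℕ) (A : Finset (ℕ × ℕ)) (n : ℕ) (c b : ℝ) :
    ∀ f : ℝ × ℝ → ℝ, En L A n (fun x => c * f x + b) = c ^ 2 * En L A n f := by
  induction n with
  | zero => intro f; show Q _ = c ^ 2 * Q f; unfold Q; ring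
  | succ n ih =>
    intro f
    show ∑ a ∈ A, _ = c ^ 2 * ∑ a ∈ A, _
    rw [Finset.mul_sum]
    exact Finset.sum_congr rfl fun a _ => ih _

lemma Sn_edge {L : ℕ} {A : Finset (ℕ × ℕ)} (n : ℕ) (f : ℝ × ℝ → ℝ) :
    Sn L A n * (f (0, 0) - f (1, 0)) ^ 2 ≤ En L A n f := by
  by_cases hd : f (0, 0) - f (1, 0) = 0
  · rw [hd]; simpa using En_nonneg L A n f
  set d := f (0, 0) - f (1, 0) with hdd
  have h1 := Sn_le (L := L) (A := A) n (f := fun x => d⁻¹ * f x + (-(d⁻¹ * f (1, 0))))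
    (by
      have : d⁻¹ * f (0, 0) + -(d⁻¹ * f (1, 0)) = d⁻¹ * d := by rw [hdd]; ring
      simp only [this]
      exact inv_mul_cancel₀ hd)
    (by simp)
  rw [En_affine] at h1
  have hd2 : 0 < d ^ 2 := by positivity
  calc Sn L A n * d ^ 2 ≤ ((d⁻¹) ^ 2 * En L A n f) * d ^ 2 := by gcongr
    _ = En L A n f := by field_simp

lemma Sn_step {L : ℕ} {A : Finset (ℕ × ℕ)} (h : GoodCarpet L A) (n : ℕ) :
    Sn L A (n + 1) ≤ (1 - 1 / (4 * (L : ℝ) ^ 4)) * Sn L A n := by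
  have hL3 := h.three_le
  have hL1 : (3 : ℝ) ≤ L := by exact_mod_cast hL3
  have hL : (0 : ℝ) < L := by linarith
  have h4 : (1 : ℝ) ≤ (L : ℝ) ^ 4 := one_le_pow₀ (by linarith)
  have hr : 0 < 1 - 1 / (4 * (L : ℝ) ^ 4) := by
    rw [sub_pos, div_lt_one (by positivity)]; linarith
  rw [← div_le_iff₀' hr]
  refine le_Sn n fun f h1 h0 => ?_
  rw [div_le_iff₀' hr]
  refine le_trans (Sn_le (n + 1) ?_ ?_) (En_lat h n f)
  · have := lat_cell (N := (L : ℝ) ^ n) (by positivity) f (0, 0) 0 0 (by simp) (by simp)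
    simpa [bil, h1] using this
  · have := lat_cell (N := (L : ℝ) ^ n) (by positivity) f (0, 0) (L ^ n) 0 (by simp) (by simp)
    have e : ((L : ℝ) ^ n) / (L : ℝ) ^ n = 1 := div_self (by positivity)
    simpa [bil, h0, e] using this

lemma RR_lower {L : ℕ} {A : Finset (ℕ × ℕ)} (h : GoodCarpet L A) (n : ℕ) :
    1 / Sn L A n ≤ 16 * RR L A n := by
  have hS := Sn_pos h n
  unfold RR EffRes
  simp only [Set.mem_singleton_iff, forall_eq]
  set T := sInf {e : ℝ | ∃ f : ℝ × ℝ → ℝ, f (0, 0) = 1 ∧ f (1, 0) = 0 ∧ e = Dform L A n f} with hT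
  have t1 : Sn L A n / 8 ≤ T := by
    refine le_csInf ⟨_, fun x => 1 - x.1, by simp, by simp, rfl⟩ ?_
    rintro e ⟨g, h1, h2, rfl⟩
    have := Sn_le (L := L) (A := A) n h1 h2
    have := En_le_Dform h n g
    linarith
  have t2 : T / 16 ≤ Sn L A n := by
    refine le_Sn n fun f h1 h0 => ?_
    have a1 : T ≤ Dform L A n f := by
      refine csInf_le ⟨0, ?_⟩ ⟨f, h1, h0, rfl⟩
      rintro e ⟨g, _, _, rfl⟩
      have := En_le_Dform h n g
      have := En_nonneg L A n g
      linarith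
    have := Dform_le_En (L := L) (A := A) n f
    linarith
  have hT0 : 0 < T := by linarith
  rw [← div_eq_mul_inv, div_le_div_iff₀ hS hT0]
  linarith

/-- Square root of normalised energy. -/
noncomputable def osc (L : ℕ) (A : Finset (ℕ × ℕ)) (n : ℕ) (f : ℝ × ℝ → ℝ) : ℝ :=
  Real.sqrt (En L A n f / Sn L A n)

lemma osc_nonneg (L : ℕ) (A : Finset (ℕ × ℕ)) (n : ℕ) (f : ℝ × ℝ → ℝ) : 0 ≤ osc L A n f :=
  Real.sqrt_nonneg _

/-- The coordinate swap. -/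
def swp (x : ℝ × ℝ) : ℝ × ℝ := (x.2, x.1)

/-- The reflection in the vertical midline. -/
noncomputable def rfx (x : ℝ × ℝ) : ℝ × ℝ := (1 - x.1, x.2)

lemma En_swp {L : ℕ} {A : Finset (ℕ × ℕ)} (h : GoodCarpet L A) (n : ℕ) :
    ∀ f : ℝ × ℝ → ℝ, En L A n (f ∘ swp) = En L A n f := by
  induction n with
  | zero =>
    intro f
    show Q (f ∘ swp) = Q f
    simp only [Q, swp, Function.comp]; ring
  | succ n ih =>
    intro f
    show ∑ a ∈ A, En L A n ((f ∘ swp) ∘ Psi L a) = ∑ a ∈ A, En L A n (f ∘ Psi L a)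
    refine Finset.sum_bij' (fun a _ => (a.2, a.1)) (fun a _ => (a.2, a.1)) ?_ ?_ ?_ ?_ ?_
    · intro a ha; exact h.symm_swap _ _ ha
    · intro a ha; exact h.symm_swap _ _ ha
    · intro a _; rfl
    · intro a _; rfl
    · intro a _
      rw [← ih (f ∘ Psi L (a.2, a.1))]
      rfl

lemma En_rfx {L : ℕ} {A : Finset (ℕ × ℕ)} (h : GoodCarpet L A) (n : ℕ) :
    ∀ f : ℝ × ℝ → ℝ, En L A n (f ∘ rfx) = En L A n f := by
  have hL3 := h.three_le
  have hL : (0 : ℝ) < L := by exact_mod_cast (by omega : 0 < L)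
  induction n with
  | zero =>
    intro f
    show Q (f ∘ rfx) = Q f
    simp only [Q, rfx, Function.comp, sub_zero, sub_self]; ring
  | succ n ih =>
    intro f
    show ∑ a ∈ A, En L A n ((f ∘ rfx) ∘ Psi L a) = ∑ a ∈ A, En L A n (f ∘ Psi L a)
    refine Finset.sum_bij' (fun a _ => (L - 1 - a.1, a.2)) (fun a _ => (L - 1 - a.1, a.2))
      ?_ ?_ ?_ ?_ ?_
    · intro a ha; exact h.symm_reflect _ _ ha
    · intro a ha; exact h.symm_reflect _ _ ha
    · intro a ha
      have := (h.mem_lt a ha).1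
      exact Prod.ext (by simp only; omega) rfl
    · intro a ha
      have := (h.mem_lt a ha).1
      exact Prod.ext (by simp only; omega) rfl
    · intro a ha
      have hlt := (h.mem_lt a ha).1
      rw [← ih (f ∘ Psi L (L - 1 - a.1, a.2))]
      congr 1
      funext x
      simp only [Function.comp, rfx, Psi]
      rw [Nat.cast_sub (by omega), Nat.cast_sub (by omega)]
      congr 2
      push_cast
      field_simp
      ring

lemma edge_osc {L : ℕ} {A : Finset (ℕ × ℕ)} (h : GoodCarpet L A) (n : ℕ) (f : ℝ × ℝ → ℝ) :
    |f (0, 0) - f (1, 0)| ≤ osc L A n f := by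
  apply Real.abs_le_sqrt
  rw [le_div_iff₀ (Sn_pos h n), mul_comm]
  exact Sn_edge n f

lemma osc_congr {L : ℕ} {A : Finset (ℕ × ℕ)} {n : ℕ} {f g : ℝ × ℝ → ℝ}
    (e : En L A n f = En L A n g) : osc L A n f = osc L A n g := by
  unfold osc; rw [e]

lemma corner_osc {L : ℕ} {A : Finset (ℕ × ℕ)} (h : GoodCarpet L A) (n : ℕ) (f : ℝ × ℝ → ℝ)
    {p q : ℝ × ℝ} (hp : p ∈ V0) (hq : q ∈ V0) :
    |f p - f q| ≤ 2 * osc L A n f := by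
  have e1 : ∀ f, |f (0, 0) - f (1, 0)| ≤ osc L A n f := edge_osc h n
  have e2 : ∀ f, |f (0, 0) - f (0, 1)| ≤ osc L A n f := by
    intro f
    have := e1 (f ∘ swp)
    rw [osc_congr (En_swp h n f)] at this
    exact this
  have e3 : ∀ f, |f (1, 0) - f (1, 1)| ≤ osc L A n f := by
    intro f
    have := e2 (f ∘ rfx)
    rw [osc_congr (En_rfx h n f)] at this
    simpa [rfx] using this
  have e4 : ∀ f, |f (0, 1) - f (1, 1)| ≤ osc L A n f := by
    intro f
    have := e3 (f ∘ swp)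
    rw [osc_congr (En_swp h n f)] at this
    exact this
  have a1 := abs_le.1 (e1 f)
  have a2 := abs_le.1 (e2 f)
  have a3 := abs_le.1 (e3 f)
  have a4 := abs_le.1 (e4 f)
  have a0 := osc_nonneg L A n f
  rcases p with ⟨a, b⟩
  rcases q with ⟨c, d⟩
  obtain ⟨h1, h2⟩ := (mem_V0 _).1 hp
  obtain ⟨h3, h4⟩ := (mem_V0 _).1 hq
  simp only at h1 h2 h3 h4
  rw [abs_le]
  rcases h1 with rfl | rfl <;> rcases h2 with rfl | rfl <;> rcases h3 with rfl | rfl <;>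
    rcases h4 with rfl | rfl <;> constructor <;> linarith [a1.1, a1.2, a2.1, a2.2, a3.1, a3.2,
      a4.1, a4.2]

lemma carpet_conn {L : ℕ} {A : Finset (ℕ × ℕ)} (h : GoodCarpet L A) (P : ℕ × ℕ → Prop)
    (h0 : P (0, 0))
    (hs : ∀ a ∈ A, ∀ b ∈ A, P a → a.1 ≤ b.1 + 1 → b.1 ≤ a.1 + 1 → a.2 ≤ b.2 + 1 →
      b.2 ≤ a.2 + 1 → P b) : ∀ a ∈ A, P a := by
  by_contra hcon
  push Not at hcon
  obtain ⟨a, ha, hPa⟩ := hcon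
  have hL3 := h.three_le
  have hL : (0 : ℝ) < L := by exact_mod_cast (by omega : 0 < L)
  have h00 : ((0, 0) : ℕ × ℕ) ∈ A := h.flat_border 0 0 (by omega) (by omega) (by simp)
  set sq : ℕ × ℕ → Set (ℝ × ℝ) := fun p =>
    Set.Icc (((p.1 : ℝ) / L, (p.2 : ℝ) / L) : ℝ × ℝ)
      ((((p.1 : ℝ) + 1) / L, ((p.2 : ℝ) + 1) / L) : ℝ × ℝ) with hsq
  have hconn : IsConnected (⋃ p ∈ A, sq p) := h.connected
  have self : ∀ p : ℕ × ℕ, (((p.1 : ℝ) / L, (p.2 : ℝ) / L) : ℝ × ℝ) ∈ sq p := by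
    intro p
    refine ⟨le_refl _, ?_, ?_⟩
    · show (p.1 : ℝ) / L ≤ (p.1 + 1) / L
      gcongr; linarith
    · show (p.2 : ℝ) / L ≤ (p.2 + 1) / L
      gcongr; linarith
  have closed : ∀ B : Finset (ℕ × ℕ), IsClosed (⋃ p ∈ B, sq p) := by
    intro B
    exact Set.Finite.isClosed_biUnion B.finite_toSet fun p _ => isClosed_Icc
  have cl := isPreconnected_closed_iff.1 hconn.2 (⋃ p ∈ A.filter P, sq p)
    (⋃ p ∈ A.filter (fun p => ¬ P p), sq p) (closed _) (closed _) ?_ ?_ ?_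
  · obtain ⟨x, _, hx1, hx2⟩ := cl
    simp only [Set.mem_iUnion, Finset.mem_filter, exists_prop] at hx1 hx2
    obtain ⟨b, ⟨hb, hPb⟩, ⟨b1, b2⟩, ⟨b3, b4⟩⟩ := hx1
    obtain ⟨c, ⟨hc, hPc⟩, ⟨c1, c2⟩, ⟨c3, c4⟩⟩ := hx2
    simp only [div_le_iff₀ hL, le_div_iff₀ hL] at b1 b2 b3 b4 c1 c2 c3 c4
    apply hPc
    refine hs b hb c hc hPb ?_ ?_ ?_ ?_
    · exact_mod_cast b1.trans c3
    · exact_mod_cast c1.trans b3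
    · exact_mod_cast b2.trans c4
    · exact_mod_cast c2.trans b4
  · intro x hx
    simp only [Set.mem_union, Set.mem_iUnion, Finset.mem_filter, exists_prop] at hx ⊢
    obtain ⟨b, hb, hxb⟩ := hx
    by_cases hPb : P b
    · exact Or.inl ⟨b, ⟨hb, hPb⟩, hxb⟩
    · exact Or.inr ⟨b, ⟨hb, hPb⟩, hxb⟩
  · refine ⟨_, Set.mem_biUnion h00 (self _), ?_⟩
    simp only [Set.mem_iUnion, Finset.mem_filter, exists_prop]
    exact ⟨_, ⟨h00, h0⟩, self _⟩
  · refine ⟨_, Set.mem_biUnion ha (self _), ?_⟩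
    simp only [Set.mem_iUnion, Finset.mem_filter, exists_prop]
    exact ⟨_, ⟨ha, hPa⟩, self _⟩

lemma level_one {L : ℕ} {A : Finset (ℕ × ℕ)} (h : GoodCarpet L A) :
    ∃ N : ℝ, 0 ≤ N ∧ ∀ a ∈ A, ∀ (n : ℕ) (f : ℝ × ℝ → ℝ),
      |f (Psi L a (0, 0)) - f (0, 0)| ≤ N * Real.sqrt (En L A (n + 1) f / Sn L A n) := by
  have hc := carpet_conn h
    (fun a => ∃ N : ℝ, 0 ≤ N ∧ ∀ (n : ℕ) (f : ℝ × ℝ → ℝ),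
      |f (Psi L a (0, 0)) - f (0, 0)| ≤ N * Real.sqrt (En L A (n + 1) f / Sn L A n))
    ⟨0, le_refl _, fun n f => by simp [Psi]⟩ ?_
  · choose! N hN0 hN using hc
    refine ⟨∑ a ∈ A, N a, Finset.sum_nonneg hN0, fun a ha n f => (hN a ha n f).trans ?_⟩
    exact mul_le_mul_of_nonneg_right (Finset.single_le_sum hN0 ha) (Real.sqrt_nonneg _)
  · rintro a ha b hb ⟨N, hN0, hN⟩ h1 h2 h3 h4
    refine ⟨N + 4, by linarith, fun n f => ?_⟩
    obtain ⟨p, hp, q, hq, e1, e2⟩ := share_corner h1 h2 h3 h4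
    have epq : Psi L a p = Psi L b q := by simp only [Psi, e1, e2]
    have z : ((0, 0) : ℝ × ℝ) ∈ V0 := by simp [mem_V0]
    have cell : ∀ c ∈ A, ∀ p ∈ V0, ∀ q ∈ V0, |f (Psi L c p) - f (Psi L c q)| ≤
        2 * Real.sqrt (En L A (n + 1) f / Sn L A n) := by
      intro c hc p hp q hq
      refine (corner_osc h n (f ∘ Psi L c) hp hq).trans ?_
      unfold osc
      have := Sn_pos h n
      have := En_sub_le L A n f hc
      gcongr
    have k1 := cell a ha p hp _ z
    have k2 := cell b hb _ z q hq
    have k3 := hN n f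
    have : f (Psi L b (0, 0)) - f (0, 0) = (f (Psi L b (0, 0)) - f (Psi L b q)) +
        (f (Psi L a p) - f (Psi L a (0, 0))) + (f (Psi L a (0, 0)) - f (0, 0)) := by
      rw [epq]; ring
    rw [this]
    refine (abs_add_three _ _ _).trans ?_
    linarith

/-- The contraction ratio. -/
noncomputable def rat (L : ℕ) : ℝ := 1 - 1 / (4 * (L : ℝ) ^ 4)

lemma rat_bounds {L : ℕ} (hL3 : 3 ≤ L) : 1 / 2 ≤ rat L ∧ rat L < 1 := by
  have hL1 : (3 : ℝ) ≤ L := by exact_mod_cast hL3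
  have h4 : (1 : ℝ) ≤ (L : ℝ) ^ 4 := one_le_pow₀ (by linarith)
  have h5 : 1 / (4 * (L : ℝ) ^ 4) ≤ 1 / 2 := by
    rw [div_le_div_iff₀ (by positivity) (by norm_num)]; linarith
  have h6 : 0 < 1 / (4 * (L : ℝ) ^ 4) := by positivity
  unfold rat
  constructor <;> linarith

lemma Sn_steps {L : ℕ} {A : Finset (ℕ × ℕ)} (h : GoodCarpet L A) (n k : ℕ) :
    Sn L A (n + k) ≤ rat L ^ k * Sn L A n := by
  have hr := (rat_bounds h.three_le).1
  induction k with
  | zero => simp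
  | succ k ih =>
    calc Sn L A (n + k + 1) ≤ rat L * Sn L A (n + k) := Sn_step h (n + k)
      _ ≤ rat L * (rat L ^ k * Sn L A n) := by gcongr
      _ = rat L ^ (k + 1) * Sn L A n := by ring

lemma osc_scale {L : ℕ} {A : Finset (ℕ × ℕ)} (h : GoodCarpet L A) (n k : ℕ) {E : ℝ}
    (f : ℝ × ℝ → ℝ) (hE : E ≤ En L A (n + k) f) :
    Real.sqrt (E / Sn L A n) ≤ Real.sqrt (rat L ^ k) * osc L A (n + k) f := by
  have hr := (rat_bounds h.three_le).1
  have h1 := Sn_pos h n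
  have h2 := Sn_pos h (n + k)
  unfold osc
  rw [← Real.sqrt_mul (by positivity)]
  apply Real.sqrt_le_sqrt
  rw [← mul_div_assoc, div_le_div_iff₀ h1 h2]
  have h3 := Sn_steps h n k
  have h4 := En_nonneg L A (n + k) f
  calc E * Sn L A (n + k) ≤ En L A (n + k) f * Sn L A (n + k) := by gcongr
    _ ≤ En L A (n + k) f * (rat L ^ k * Sn L A n) := by gcongr
    _ = _ := by ring

lemma vertex_osc {L : ℕ} {A : Finset (ℕ × ℕ)} (h : GoodCarpet L A) :
    ∃ C : ℝ, 0 ≤ C ∧ ∀ (n : ℕ) (f : ℝ × ℝ → ℝ), ∀ x ∈ VN L A n,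
      |f x - f (0, 0)| ≤ C * osc L A n f := by
  obtain ⟨N, hN0, hN⟩ := level_one h
  obtain ⟨hr1, hr2⟩ := rat_bounds h.three_le
  set l := Real.sqrt (rat L ^ 1) with hl
  have l0 : 0 ≤ l := Real.sqrt_nonneg _
  have l1 : l < 1 := by
    rw [hl, Real.sqrt_lt' one_pos]; simpa using hr2
  have l1' : 0 < 1 - l := by linarith
  refine ⟨2 + N * l / (1 - l), by positivity, ?_⟩
  set C := 2 + N * l / (1 - l) with hC
  have hC0 : 0 ≤ C := by positivity
  have hCl : (C + N) * l ≤ C := by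
    have : N * l = (C - 2) * (1 - l) := by rw [hC]; field_simp; ring
    nlinarith
  intro n
  induction n with
  | zero =>
    intro f x hx
    obtain ⟨w, p, hp, rfl⟩ := mem_VN.1 hx
    rw [PsiW_zero]
    refine (corner_osc h 0 f hp (by simp [mem_V0] : ((0, 0) : ℝ × ℝ) ∈ V0)).trans ?_
    refine mul_le_mul_of_nonneg_right ?_ (osc_nonneg _ _ _ _)
    have : 0 ≤ N * l / (1 - l) := by positivity
    rw [hC]; linarith
  | succ n ih =>
    intro f x hx
    obtain ⟨a, ha, y, hy, rfl⟩ := mem_VN_succ.1 hx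
    have k1 := ih (f ∘ Psi L a) y hy
    have k2 := hN a ha n f
    have k3 := osc_scale h n 1 f (En_sub_le L A n f ha)
    have k4 := osc_scale h n 1 f (le_refl (En L A (n + 1) f))
    have k0 := osc_nonneg L A (n + 1) f
    have k1' : |f (Psi L a y) - f (Psi L a (0, 0))| ≤ C * (l * osc L A (n + 1) f) :=
      k1.trans (mul_le_mul_of_nonneg_left k3 hC0)
    have k2' := k2.trans (mul_le_mul_of_nonneg_left k4 hN0)
    have : f (Psi L a y) - f (0, 0) = (f (Psi L a y) - f (Psi L a (0, 0))) +
      (f (Psi L a (0, 0)) - f (0, 0)) := by ring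
    rw [this]
    calc _ ≤ C * (l * osc L A (n + 1) f) + N * (l * osc L A (n + 1) f) :=
          (abs_add_le _ _).trans (add_le_add k1' k2')
      _ = (C + N) * l * osc L A (n + 1) f := by ring
      _ ≤ C * osc L A (n + 1) f := by gcongr

/-- Estimate for two points closer than the size of a level-`k` cell. -/
lemma close_pts {L : ℕ} {A : Finset (ℕ × ℕ)} (h : GoodCarpet L A) {C : ℝ} (hC0 : 0 ≤ C)
    (hC : ∀ (n : ℕ) (f : ℝ × ℝ → ℝ), ∀ x ∈ VN L A n, |f x - f (0, 0)| ≤ C * osc L A n f)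
    (n k : ℕ) (f : ℝ × ℝ → ℝ) {x y : ℝ × ℝ} (hx : x ∈ VN L A (n + k)) (hy : y ∈ VN L A (n + k))
    (hxy : k = 0 ∨ eudist x y * (L : ℝ) ^ k < 1) :
    |f x - f y| ≤ 4 * C * (Real.sqrt (rat L ^ k) * osc L A (n + k) f) := by
  have hL3 := h.three_le
  have hL : 0 < L := by omega
  have hLr : (0 : ℝ) < L := by exact_mod_cast hL
  have hLk : (0 : ℝ) < (L : ℝ) ^ k := by positivity
  obtain ⟨w, u, hu, rfl⟩ := VN_split k hx
  obtain ⟨w', v, hv, rfl⟩ := VN_split k hy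
  have cell : ∀ (w : Word A k), ∀ u ∈ VN L A n, ∀ p ∈ V0, |f (PsiW L w u) - f (PsiW L w p)| ≤
      2 * C * (Real.sqrt (rat L ^ k) * osc L A (n + k) f) := by
    intro w u hu p hp
    have k1 := hC n (f ∘ PsiW L w) u hu
    have k2 := hC n (f ∘ PsiW L w) p (V0_sub_VN h n p hp)
    have k3 := mul_le_mul_of_nonneg_left (osc_scale h n k f (En_cell_le L A n k f w)) hC0
    have k1' := k1.trans k3
    have k2' := k2.trans k3
    rw [abs_sub_comm] at k2'
    refine (abs_sub_le _ ((f ∘ PsiW L w) (0, 0)) _).trans ((add_le_add k1' k2').trans ?_)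
    linarith
  have share : ∃ p ∈ V0, ∃ q ∈ V0, PsiW L w p = PsiW L w' q := by
    rcases hxy with rfl | hxy
    · exact ⟨(0, 0), by simp [mem_V0], (0, 0), by simp [mem_V0], by simp [PsiW_zero]⟩
    obtain ⟨i, j, hij⟩ := PsiW_form hL k w
    obtain ⟨i', j', hij'⟩ := PsiW_form hL k w'
    obtain ⟨⟨u1, u2⟩, u3, u4⟩ := VN_mem_Icc h n u hu
    obtain ⟨⟨v1, v2⟩, v3, v4⟩ := VN_mem_Icc h n v hv
    rw [hij, hij'] at hxy
    have d1 : |(u.1 + i) / (L : ℝ) ^ k - (v.1 + i') / (L : ℝ) ^ k| ≤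
        eudist ((u.1 + i) / (L : ℝ) ^ k, (u.2 + j) / (L : ℝ) ^ k)
          ((v.1 + i') / (L : ℝ) ^ k, (v.2 + j') / (L : ℝ) ^ k) := by
      apply Real.abs_le_sqrt
      have := sq_nonneg ((u.2 + j) / (L : ℝ) ^ k - (v.2 + j') / (L : ℝ) ^ k)
      simp only; linarith
    have d2 : |(u.2 + j) / (L : ℝ) ^ k - (v.2 + j') / (L : ℝ) ^ k| ≤
        eudist ((u.1 + i) / (L : ℝ) ^ k, (u.2 + j) / (L : ℝ) ^ k)
          ((v.1 + i') / (L : ℝ) ^ k, (v.2 + j') / (L : ℝ) ^ k) := by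
      apply Real.abs_le_sqrt
      have := sq_nonneg ((u.1 + i) / (L : ℝ) ^ k - (v.1 + i') / (L : ℝ) ^ k)
      simp only; linarith
    have conv : ∀ a b D : ℝ, |a / (L : ℝ) ^ k - b / (L : ℝ) ^ k| ≤ D → D * (L : ℝ) ^ k < 1 →
        a - b < 1 ∧ b - a < 1 := by
      intro a b D h1 h2
      rw [← sub_div, abs_div, abs_of_pos hLk, div_le_iff₀ hLk] at h1
      have := abs_lt.1 (h1.trans_lt h2)
      exact ⟨this.2, by linarith [this.1]⟩
    obtain ⟨c1, c2⟩ := conv _ _ _ d1 hxy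
    obtain ⟨c3, c4⟩ := conv _ _ _ d2 hxy
    have i1 : (i : ℝ) < (i' + 1 : ℕ) + 1 := by push_cast; linarith
    have i2 : (i' : ℝ) < (i + 1 : ℕ) + 1 := by push_cast; linarith
    have i3 : (j : ℝ) < (j' + 1 : ℕ) + 1 := by push_cast; linarith
    have i4 : (j' : ℝ) < (j + 1 : ℕ) + 1 := by push_cast; linarith
    obtain ⟨p, hp, q, hq, e1, e2⟩ := share_corner (i := i) (i' := i') (j := j) (j' := j')
      (Nat.lt_succ_iff.1 (by exact_mod_cast i1)) (Nat.lt_succ_iff.1 (by exact_mod_cast i2))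
      (Nat.lt_succ_iff.1 (by exact_mod_cast i3)) (Nat.lt_succ_iff.1 (by exact_mod_cast i4))
    exact ⟨p, hp, q, hq, by rw [hij, hij', e1, e2]⟩
  obtain ⟨p, hp, q, hq, epq⟩ := share
  have k1 := cell w u hu p hp
  have k2 := cell w' v hv q hq
  rw [abs_sub_comm, ← epq] at k2
  refine (abs_sub_le _ (f (PsiW L w p)) _).trans ((add_le_add k1 k2).trans ?_)
  linarith

/-- Distinct vertices of level `m` have distance at least `L^{-m}`. -/
lemma sep_pts {L : ℕ} {A : Finset (ℕ × ℕ)} (h : GoodCarpet L A) (m : ℕ) {x y : ℝ × ℝ}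
    (hx : x ∈ VN L A m) (hy : y ∈ VN L A m) (hxy : eudist x y * (L : ℝ) ^ m < 1) : x = y := by
  have hL3 := h.three_le
  have hL : 0 < L := by omega
  have hLr : (0 : ℝ) < L := by exact_mod_cast hL
  have hLk : (0 : ℝ) < (L : ℝ) ^ m := by positivity
  have form : ∀ x ∈ VN L A m, ∃ i j : ℤ, x = (i / (L : ℝ) ^ m, j / (L : ℝ) ^ m) := by
    intro x hx
    obtain ⟨w, p, hp, rfl⟩ := mem_VN.1 hx
    obtain ⟨i, j, hij⟩ := PsiW_form hL m w
    obtain ⟨h1, h2⟩ := (mem_V0 p).1 hp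
    have int : ∀ s : ℝ, s = 0 ∨ s = 1 → ∃ z : ℤ, s = z := by
      rintro s (rfl | rfl)
      · exact ⟨0, by simp⟩
      · exact ⟨1, by simp⟩
    obtain ⟨z, hz⟩ := int _ h1
    obtain ⟨z', hz'⟩ := int _ h2
    refine ⟨z + i, z' + j, ?_⟩
    rw [hij, hz, hz']; push_cast; rfl
  obtain ⟨i, j, rfl⟩ := form x hx
  obtain ⟨i', j', rfl⟩ := form y hy
  have one : ∀ (i i' : ℤ) (D : ℝ), |i / (L : ℝ) ^ m - i' / (L : ℝ) ^ m| ≤ D →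
      D * (L : ℝ) ^ m < 1 → i = i' := by
    intro i i' D h1 h2
    rw [← sub_div, abs_div, abs_of_pos hLk, div_le_iff₀ hLk] at h1
    have h3 : |((i - i' : ℤ) : ℝ)| < 1 := by push_cast; exact h1.trans_lt h2
    have h4 : |i - i'| < 1 := by exact_mod_cast h3
    have := Int.abs_lt_one_iff.1 h4
    omega
  have d1 : i = i' := by
    refine one i i' _ (Real.abs_le_sqrt ?_) hxy
    have := sq_nonneg ((j : ℝ) / (L : ℝ) ^ m - j' / (L : ℝ) ^ m)
    simp only; linarith
  have d2 : j = j' := by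
    refine one j j' _ (Real.abs_le_sqrt ?_) hxy
    have := sq_nonneg ((i : ℝ) / (L : ℝ) ^ m - i' / (L : ℝ) ^ m)
    simp only; linarith
  rw [d1, d2]

/-- Corollary 3.6, planar case: uniform Hölder estimate on the
approximating graphs. -/
theorem graph_holder (L : ℕ) (A : Finset (ℕ × ℕ)) (h : GoodCarpet L A) :
    ∃ c θ : ℝ, 1 ≤ c ∧ 0 < θ ∧ θ < 2 ∧
      ∀ (m : ℕ) (f : ℝ × ℝ → ℝ), ∀ x ∈ VN L A m, ∀ y ∈ VN L A m,
        |f x - f y| ^ 2 ≤ c * eudist x y ^ θ * (RR L A m * Dform L A m f) := by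
  obtain ⟨C, hC0, hC⟩ := vertex_osc h
  obtain ⟨hr1, hr2⟩ := rat_bounds h.three_le
  have hr0 : 0 < rat L := by linarith
  have hL3 : (3 : ℝ) ≤ L := by exact_mod_cast h.three_le
  have hL : (0 : ℝ) < L := by linarith
  have hlog : 0 < Real.log L := Real.log_pos (by linarith)
  set θ : ℝ := -Real.log (rat L) / Real.log L with hθ
  have hθ0 : 0 < θ := div_pos (by linarith [Real.log_neg hr0 hr2]) hlog
  have hθ2 : θ < 2 := by
    rw [hθ, div_lt_iff₀ hlog]
    have : Real.log 1 < Real.log (rat L * L ^ 2) := by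
      apply Real.log_lt_log one_pos
      nlinarith
    rw [Real.log_one, Real.log_mul hr0.ne' (by positivity), Real.log_pow] at this
    push_cast at this
    linarith
  have hLθ : (L : ℝ) ^ (-θ) = rat L := by
    rw [Real.rpow_def_of_pos hL, hθ]
    have : Real.log L * -(-Real.log (rat L) / Real.log L) = Real.log (rat L) := by
      field_simp
    rw [this, Real.exp_log hr0]
  -- scale factor
  have scale : ∀ (k : ℕ) (d : ℝ), 1 ≤ d * (L : ℝ) ^ (k + 1) → 0 < d →
      rat L ^ k ≤ 2 * d ^ θ := by
    intro k d hd hd0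
    have h1 : (1 : ℝ) ≤ (d * (L : ℝ) ^ (k + 1)) ^ θ := Real.one_le_rpow hd hθ0.le
    rw [Real.mul_rpow hd0.le (by positivity), ← Real.rpow_natCast, ← Real.rpow_mul hL.le] at h1
    have h2 : (L : ℝ) ^ (((k + 1 : ℕ) : ℝ) * θ) = (rat L ^ (k + 1))⁻¹ := by
      rw [← hLθ, ← Real.rpow_natCast, ← Real.rpow_mul hL.le, ← Real.rpow_neg hL.le]
      congr 1; ring
    rw [h2, ← div_eq_mul_inv, le_div_iff₀ (by positivity), one_mul, pow_succ] at h1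
    have h3 : 0 ≤ rat L ^ k := by positivity
    nlinarith
  refine ⟨(4 * C) ^ 2 * 256 + 1, θ, by nlinarith [sq_nonneg (4 * C)], hθ0, hθ2, ?_⟩
  intro m f x hx y hy
  have hED := En_le_Dform h m f
  have hE0 := En_nonneg L A m f
  have hS := Sn_pos h m
  have hRR := RR_lower h m
  have hRR0 : 0 ≤ RR L A m := by
    have : 0 < 1 / Sn L A m := by positivity
    linarith
  have hD0 : 0 ≤ Dform L A m f := by linarith
  by_cases hxy : x = y
  · subst hxy
    have : eudist x x = 0 := by simp [eudist]
    rw [this, Real.zero_rpow hθ0.ne']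
    simp
  have hm : 1 ≤ eudist x y * (L : ℝ) ^ m := by
    by_contra hcon
    exact hxy (sep_pts h m hx hy (not_le.1 hcon))
  have hd0 : 0 < eudist x y := by
    by_contra hcon
    have : eudist x y * (L : ℝ) ^ m ≤ 0 :=
      mul_nonpos_of_nonpos_of_nonneg (not_lt.1 hcon) (by positivity)
    linarith
  -- choose the scale
  have hk : ∃ k, k ≤ m ∧ (k = 0 ∨ eudist x y * (L : ℝ) ^ k < 1) ∧
      1 ≤ eudist x y * (L : ℝ) ^ (k + 1) := by
    have hex : ∃ k, 1 ≤ eudist x y * (L : ℝ) ^ (k + 1) :=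
      ⟨m, hm.trans (by gcongr <;> [linarith; omega])⟩
    refine ⟨Nat.find hex, Nat.find_min' hex (hm.trans (by gcongr <;> [linarith; omega])), ?_,
      Nat.find_spec hex⟩
    rcases Nat.eq_zero_or_pos (Nat.find hex) with h0 | h0
    · exact Or.inl h0
    · right
      have := Nat.find_min hex (m := Nat.find hex - 1) (by omega)
      rw [Nat.sub_add_cancel h0] at this
      exact not_le.1 this
  obtain ⟨k, hkm, hk1, hk2⟩ := hk
  obtain ⟨n, rfl⟩ : ∃ n, m = n + k := ⟨m - k, by omega⟩
  have main := close_pts h hC0 hC n k f hx hy hk1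
  have sc := scale k _ hk2 hd0
  have osq : osc L A (n + k) f ^ 2 ≤ 128 * (RR L A (n + k) * Dform L A (n + k) f) := by
    unfold osc
    rw [Real.sq_sqrt (by positivity)]
    calc En L A (n + k) f / Sn L A (n + k) = En L A (n + k) f * (1 / Sn L A (n + k)) := by ring
      _ ≤ (8 * Dform L A (n + k) f) * (16 * RR L A (n + k)) := by gcongr
      _ = _ := by ring
  have hd : 0 ≤ eudist x y ^ θ := by positivity
  calc |f x - f y| ^ 2 ≤ (4 * C * (Real.sqrt (rat L ^ k) * osc L A (n + k) f)) ^ 2 := by gcongr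
    _ = (4 * C) ^ 2 * (rat L ^ k * osc L A (n + k) f ^ 2) := by
        rw [mul_pow, mul_pow (Real.sqrt _), Real.sq_sqrt (by positivity)]
    _ ≤ (4 * C) ^ 2 * ((2 * eudist x y ^ θ) *
          (128 * (RR L A (n + k) * Dform L A (n + k) f))) := by gcongr
    _ = ((4 * C) ^ 2 * 256) * eudist x y ^ θ * (RR L A (n + k) * Dform L A (n + k) f) := by ring
    _ ≤ ((4 * C) ^ 2 * 256 + 1) * eudist x y ^ θ * (RR L A (n + k) * Dform L A (n + k) f) := by
        gcongr; linarith


end Carpet
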